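/- arXiv:0812.1546 — 5 statements merged into one kernel-verified Lean document; each statement's English description precedes it below -/
import Mathlib

section
/- The algebra O(SL_q(2)) is the internal direct sum, as a ℂ-vector space, of the subspaces A[m,n] over all pairs (m,n) ∈ ℤ × ℤ; that is, O(SL_q(2)) = ⨁_{(m,n)∈ℤ²} A[m,n]. -/
open scoped TensorProduct
open LaurentPolynomial

noncomputable section

namespace SLq2

/-- Free algebra on the four generators `a, b, c, d` (indexed `0,1,2,3`). -/
abbrev F : Type := FreeAlgebra ℂ (Fin 4)

/-- The generators of the free algebra. -/
def X (i : Fin 4) : F := FreeAlgebra.ι ℂ i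

/-- The defining relations of `O(SL_q(2))`:
`ab = q ba`, `ac = q ca`, `bd = q db`, `cd = q dc`, `bc = cb`,
`ad - da = (q - q⁻¹) bc`, `ad - q bc = 1`. -/
inductive Rel (q : ℝ) : F → F → Prop
  | ab : Rel q (X 0 * X 1) ((q : ℂ) • (X 1 * X 0))
  | ac : Rel q (X 0 * X 2) ((q : ℂ) • (X 2 * X 0))
  | bd : Rel q (X 1 * X 3) ((q : ℂ) • (X 3 * X 1))
  | cd : Rel q (X 2 * X 3) ((q : ℂ) • (X 3 * X 2))
  | bc : Rel q (X 1 * X 2) (X 2 * X 1)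
  | adda : Rel q (X 0 * X 3 - X 3 * X 0) (((q : ℂ) - (q : ℂ)⁻¹) • (X 1 * X 2))
  | det : Rel q (X 0 * X 3 - (q : ℂ) • (X 1 * X 2)) 1

/-- `O(SL_q(2))`, the universal `ℂ`-algebra on `a,b,c,d` with the above relations. -/
abbrev A (q : ℝ) : Type := RingQuot (Rel q)

def a (q : ℝ) : A q := RingQuot.mkAlgHom ℂ (Rel q) (X 0)
def b (q : ℝ) : A q := RingQuot.mkAlgHom ℂ (Rel q) (X 1)
def c (q : ℝ) : A q := RingQuot.mkAlgHom ℂ (Rel q) (X 2)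
def d (q : ℝ) : A q := RingQuot.mkAlgHom ℂ (Rel q) (X 3)

variable {q : ℝ}

/-- `L_K = (φ ⊗ id) ∘ Δ`. -/
def LK (Δ : A q →ₐ[ℂ] A q ⊗[ℂ] A q) (φ : A q →ₐ[ℂ] LaurentPolynomial ℂ) :
    A q →ₗ[ℂ] LaurentPolynomial ℂ ⊗[ℂ] A q :=
  (TensorProduct.map φ.toLinearMap LinearMap.id).comp Δ.toLinearMap

/-- `R_K = (id ⊗ φ) ∘ Δ`. -/
def RK (Δ : A q →ₐ[ℂ] A q ⊗[ℂ] A q) (φ : A q →ₐ[ℂ] LaurentPolynomial ℂ) :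
    A q →ₗ[ℂ] A q ⊗[ℂ] LaurentPolynomial ℂ :=
  (TensorProduct.map LinearMap.id φ.toLinearMap).comp Δ.toLinearMap

/-- The subspace `A[m,n] = {x | L_K x = zᵐ ⊗ x, R_K x = x ⊗ zⁿ}`. -/
def Asub (Δ : A q →ₐ[ℂ] A q ⊗[ℂ] A q) (φ : A q →ₐ[ℂ] LaurentPolynomial ℂ)
    (m n : ℤ) : Submodule ℂ (A q) where
  carrier := {x | LK Δ φ x = T m ⊗ₜ[ℂ] x ∧ RK Δ φ x = x ⊗ₜ[ℂ] T n}
  add_mem' := by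
    rintro x y ⟨hx1, hx2⟩ ⟨hy1, hy2⟩
    exact ⟨by simp [map_add, hx1, hy1, TensorProduct.tmul_add],
           by simp [map_add, hx2, hy2, TensorProduct.add_tmul]⟩
  zero_mem' := ⟨by simp, by simp⟩
  smul_mem' := by
    rintro t x ⟨h1, h2⟩
    exact ⟨by simp [map_smul, h1, TensorProduct.tmul_smul],
           by simp [map_smul, h2, TensorProduct.smul_tmul']⟩

/-- `h` is a Haar state: `h(1) = 1`, `(id ⊗ h)(Δ x) = h(x)·1` and `(h ⊗ id)(Δ x) = h(x)·1`. -/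
def IsHaarState (Δ : A q →ₐ[ℂ] A q ⊗[ℂ] A q) (h : A q →ₗ[ℂ] ℂ) : Prop :=
  h 1 = 1 ∧
  (∀ x : A q, (TensorProduct.rid ℂ (A q)) ((LinearMap.lTensor (A q) h) (Δ x)) = h x • 1) ∧
  (∀ x : A q, (TensorProduct.lid ℂ (A q)) ((LinearMap.rTensor (A q) h) (Δ x)) = h x • 1)

theorem LK_mul (Δ : A q →ₐ[ℂ] A q ⊗[ℂ] A q) (φ : A q →ₐ[ℂ] LaurentPolynomial ℂ) (x y : A q) :
    LK Δ φ (x * y) = LK Δ φ x * LK Δ φ y := by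
  have h (z : A q) : LK Δ φ z = Algebra.TensorProduct.map φ (AlgHom.id ℂ (A q)) (Δ z) := rfl
  rw [h, h, h, map_mul, map_mul]

theorem RK_mul (Δ : A q →ₐ[ℂ] A q ⊗[ℂ] A q) (φ : A q →ₐ[ℂ] LaurentPolynomial ℂ) (x y : A q) :
    RK Δ φ (x * y) = RK Δ φ x * RK Δ φ y := by
  have h (z : A q) : RK Δ φ z = Algebra.TensorProduct.map (AlgHom.id ℂ (A q)) φ (Δ z) := rfl
  rw [h, h, h, map_mul, map_mul]

theorem one_mem_Asub (Δ : A q →ₐ[ℂ] A q ⊗[ℂ] A q) (φ : A q →ₐ[ℂ] LaurentPolynomial ℂ) :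
    (1 : A q) ∈ Asub Δ φ 0 0 := by
  constructor <;> simp [LK, RK, Algebra.TensorProduct.one_def]

theorem mul_mem_Asub {Δ : A q →ₐ[ℂ] A q ⊗[ℂ] A q} {φ : A q →ₐ[ℂ] LaurentPolynomial ℂ}
    {m n m' n' : ℤ} {x y : A q} (hx : x ∈ Asub Δ φ m n) (hy : y ∈ Asub Δ φ m' n') :
    x * y ∈ Asub Δ φ (m + m') (n + n') := by
  constructor
  · rw [LK_mul, hx.1, hy.1, Algebra.TensorProduct.tmul_mul_tmul, T_add]
  · rw [RK_mul, hx.2, hy.2, Algebra.TensorProduct.tmul_mul_tmul, T_add]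

/-- The coefficient of `T k`, as a linear functional on Laurent polynomials. -/
def coeffT (k : ℤ) : LaurentPolynomial ℂ →ₗ[ℂ] ℂ where
  toFun f := f.coeff k
  map_add' _ _ := rfl
  map_smul' _ _ := rfl

theorem coeffT_T (k m : ℤ) : coeffT k (T m) = if m = k then 1 else 0 :=
  T_apply k m

/-- The projection of `A q` to the subspace of left weight `p.1` and right weight `p.2`. -/
def weightProj (Δ : A q →ₐ[ℂ] A q ⊗[ℂ] A q) (φ : A q →ₐ[ℂ] LaurentPolynomial ℂ) (p : ℤ × ℤ) :
    A q →ₗ[ℂ] A q :=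
  ((TensorProduct.lid ℂ (A q)).toLinearMap ∘ₗ (coeffT p.1).rTensor (A q) ∘ₗ LK Δ φ) ∘ₗ
    ((TensorProduct.rid ℂ (A q)).toLinearMap ∘ₗ (coeffT p.2).lTensor (A q) ∘ₗ RK Δ φ)

theorem weightProj_apply {Δ : A q →ₐ[ℂ] A q ⊗[ℂ] A q} {φ : A q →ₐ[ℂ] LaurentPolynomial ℂ}
    (p r : ℤ × ℤ) {x : A q} (hx : x ∈ Asub Δ φ r.1 r.2) :
    weightProj Δ φ p x = if r = p then x else 0 := by
  have h1 : LK Δ φ x = _ := hx.1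
  have h2 : RK Δ φ x = _ := hx.2
  simp only [weightProj, LinearMap.comp_apply, h2, LinearMap.lTensor_tmul, coeffT_T,
    LinearEquiv.coe_coe, TensorProduct.rid_tmul, map_smul, h1, LinearMap.rTensor_tmul,
    TensorProduct.lid_tmul, Prod.ext_iff]
  by_cases ha : r.1 = p.1 <;> by_cases hb : r.2 = p.2 <;> simp [ha, hb]

theorem iSup_Asub_eq_top {Δ : A q →ₐ[ℂ] A q ⊗[ℂ] A q} {φ : A q →ₐ[ℂ] LaurentPolynomial ℂ}
    (h : ∀ i : Fin 4, ∃ p : ℤ × ℤ, RingQuot.mkAlgHom ℂ (Rel q) (X i) ∈ Asub Δ φ p.1 p.2) :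
    ⨆ p : ℤ × ℤ, Asub Δ φ p.1 p.2 = ⊤ := by
  have mem {p : ℤ × ℤ} {x : A q} (hx : x ∈ Asub Δ φ p.1 p.2) :
      x ∈ ⨆ p : ℤ × ℤ, Asub Δ φ p.1 p.2 :=
    Submodule.mem_iSup_of_mem p hx
  refine Submodule.eq_top_iff'.2 fun x => ?_
  obtain ⟨y, rfl⟩ := RingQuot.mkAlgHom_surjective ℂ (Rel q) x
  induction y using FreeAlgebra.induction with
  | grade0 r =>
    rw [AlgHom.commutes, Algebra.algebraMap_eq_smul_one]
    exact Submodule.smul_mem _ _ (mem (p := (0, 0)) (one_mem_Asub Δ φ))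
  | grade1 i =>
    obtain ⟨p, hp⟩ := h i
    exact mem hp
  | add x y hx hy => rw [map_add]; exact add_mem hx hy
  | mul x y hx hy =>
    rw [map_mul]
    generalize RingQuot.mkAlgHom ℂ (Rel q) x = u at hx ⊢
    generalize RingQuot.mkAlgHom ℂ (Rel q) y = v at hy ⊢
    induction hx using Submodule.iSup_induction' with
    | mem p u hu =>
      induction hy using Submodule.iSup_induction' with
      | mem r v hv => exact mem (p := (p.1 + r.1, p.2 + r.2)) (mul_mem_Asub hu hv)
      | zero => rw [mul_zero]; exact zero_mem _
      | add v w _ _ hv hw => rw [mul_add]; exact add_mem hv hw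
    | zero => rw [zero_mul]; exact zero_mem _
    | add u w _ _ hu hw => rw [add_mul]; exact add_mem hu hw

/-- `O(SL_q(2))` is the internal direct sum, as a ℂ-vector space, of the
subspaces `A[m,n]` over all pairs `(m,n) ∈ ℤ × ℤ`. -/
theorem slq2_peter_weyl_direct_sum (q : ℝ) (hq0 : 0 < q) (hq1 : q < 1)
    (Δ : A q →ₐ[ℂ] A q ⊗[ℂ] A q)
    (hΔa : Δ (a q) = a q ⊗ₜ[ℂ] a q + b q ⊗ₜ[ℂ] c q)
    (hΔb : Δ (b q) = a q ⊗ₜ[ℂ] b q + b q ⊗ₜ[ℂ] d q)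
    (hΔc : Δ (c q) = c q ⊗ₜ[ℂ] a q + d q ⊗ₜ[ℂ] c q)
    (hΔd : Δ (d q) = c q ⊗ₜ[ℂ] b q + d q ⊗ₜ[ℂ] d q)
    (φ : A q →ₐ[ℂ] LaurentPolynomial ℂ)
    (hφa : φ (a q) = T 1) (hφb : φ (b q) = 0)
    (hφc : φ (c q) = 0) (hφd : φ (d q) = T (-1)) :
    DirectSum.IsInternal (fun p : ℤ × ℤ => Asub Δ φ p.1 p.2) := by
  constructor
  · intro x y hxy
    refine DFinsupp.ext fun p : ℤ × ℤ => Subtype.ext ?_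
    have hs (y : DirectSum (ℤ × ℤ) fun p => Asub Δ φ p.1 p.2) :
        weightProj Δ φ p (DirectSum.coeAddMonoidHom (fun p : ℤ × ℤ => Asub Δ φ p.1 p.2) y)
          = (y p : A q) := by
      induction y using DirectSum.induction_on with
      | zero => simp
      | of r u =>
        rw [DirectSum.coeAddMonoidHom_of, weightProj_apply p r u.2, DirectSum.coe_of_apply]
        split_ifs <;> rfl
      | add y z hy hz => rw [map_add, map_add, hy, hz]; rfl
    exact (hs x).symm.trans ((congrArg _ hxy).trans (hs y))
  · have htop : ⨆ p : ℤ × ℤ, Asub Δ φ p.1 p.2 = ⊤ := by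
      have ha : a q ∈ Asub Δ φ 1 1 := by
        constructor <;> simp [LK, RK, hΔa, hφa, hφb, hφc]
      have hb : b q ∈ Asub Δ φ 1 (-1) := by
        constructor <;> simp [LK, RK, hΔb, hφa, hφb, hφd]
      have hc : c q ∈ Asub Δ φ (-1) 1 := by
        constructor <;> simp [LK, RK, hΔc, hφa, hφc, hφd]
      have hd : d q ∈ Asub Δ φ (-1) (-1) := by
        constructor <;> simp [LK, RK, hΔd, hφb, hφc, hφd]
      refine iSup_Asub_eq_top fun i => ?_
      fin_cases i
      exacts [⟨(1, 1), ha⟩, ⟨(1, -1), hb⟩, ⟨(-1, 1), hc⟩, ⟨(-1, -1), hd⟩]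
    exact LinearMap.range_eq_top.1 (DirectSum.range_coeLinearMap.trans htop)

end SLq2
end
end

section
/- Let h be a Haar state on O(SL_q(2)) and set ζ = −qbc. Then h(ζ) = (1 − q⁻²)/(1 − q⁻⁴). -/
open scoped TensorProduct
open LaurentPolynomial

noncomputable section

namespace SLq2

variable {q : ℝ}

theorem a_mul_d (q : ℝ) : a q * d q = 1 + (q : ℂ) • (b q * c q) := by
  have h := RingQuot.mkAlgHom_rel ℂ (Rel.det (q := q))
  simp only [map_sub, map_mul, map_smul, map_one] at h
  exact sub_eq_iff_eq_add.mp h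

theorem d_mul_a (q : ℝ) : d q * a q = 1 + (q : ℂ)⁻¹ • (b q * c q) := by
  have h := RingQuot.mkAlgHom_rel ℂ (Rel.adda (q := q))
  simp only [map_sub, map_mul, map_smul] at h
  change a q * d q - d q * a q = ((q : ℂ) - (q : ℂ)⁻¹) • (b q * c q) at h
  rw [a_mul_d] at h
  rw [← sub_sub_self (1 + (q : ℂ) • (b q * c q)) (d q * a q), h]
  module

/-- Weighted shift `f ↦ (n ↦ w n * f (n + k))` on functions `ℤ → ℂ`. -/
def weightedShift (w : ℤ → ℂ) (k : ℤ) : Module.End ℂ (ℤ → ℂ) where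
  toFun f n := w n * f (n + k)
  map_add' f g := by ext n; simp [mul_add]
  map_smul' t f := by ext n; simp [mul_left_comm]

@[simp]
theorem weightedShift_apply (w : ℤ → ℂ) (k : ℤ) (f : ℤ → ℂ) (n : ℤ) :
    weightedShift w k f n = w n * f (n + k) := rfl

/-- The images of the generators in the representation by weighted shifts. -/
def shiftGen (q : ℝ) : Fin 4 → Module.End ℂ (ℤ → ℂ) :=
  ![weightedShift (fun n => 1 - (q : ℂ) * q * ((q : ℂ) ^ n * (q : ℂ) ^ n)) 1,
    weightedShift (fun n => -((q : ℂ) * (q : ℂ) ^ n)) 0,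
    weightedShift (fun n => (q : ℂ) ^ n) 0,
    weightedShift (fun _ => 1) (-1)]

theorem lift_shiftGen_rel {q : ℝ} (hq : q ≠ 0) ⦃x y : F⦄ (h : Rel q x y) :
    FreeAlgebra.lift ℂ (shiftGen q) x = FreeAlgebra.lift ℂ (shiftGen q) y := by
  have hq' : (q : ℂ) ≠ 0 := by exact_mod_cast hq
  cases h <;> ext f n <;>
    simp [X, shiftGen, Module.End.mul_apply, zpow_add₀ hq', zpow_sub₀ hq', ← sub_eq_add_neg,
      -Complex.coe_smul] <;>
    field_simp <;> try ring

/-- A representation of `O(SL_q(2))` on functions `ℤ → ℂ`, with `b` and `c` diagonal. -/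
def shiftRep {q : ℝ} (hq : q ≠ 0) : A q →ₐ[ℂ] Module.End ℂ (ℤ → ℂ) :=
  RingQuot.liftAlgHom ℂ ⟨FreeAlgebra.lift ℂ (shiftGen q), lift_shiftGen_rel hq⟩

theorem shiftRep_mk {q : ℝ} (hq : q ≠ 0) (i : Fin 4) :
    shiftRep hq (RingQuot.mkAlgHom ℂ (Rel q) (X i)) = shiftGen q i := by
  simp [shiftRep, X]

/-- The products `a c` and `b d` do not span `b c`. -/
theorem coeff_bc_eq_zero {q : ℝ} (hq : q ≠ 0) {r s t : ℂ}
    (h : r • (a q * c q) + s • (b q * d q) + t • (b q * c q) = 0) : t = 0 := by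
  have h0 := congrFun (LinearMap.congr_fun (congrArg (shiftRep hq) h) (Pi.single 0 1)) 0
  simpa [a, b, c, d, shiftRep_mk, shiftGen, Module.End.mul_apply, hq] using h0

/-- For a Haar state `h` on `O(SL_q(2))` and `ζ = −q·bc`,
`h(ζ) = (1 − q⁻²)/(1 − q⁻⁴)`. -/
theorem slq2_haar_zeta (q : ℝ) (hq0 : 0 < q) (hq1 : q < 1)
    (Δ : A q →ₐ[ℂ] A q ⊗[ℂ] A q)
    (hΔa : Δ (a q) = a q ⊗ₜ[ℂ] a q + b q ⊗ₜ[ℂ] c q)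
    (hΔb : Δ (b q) = a q ⊗ₜ[ℂ] b q + b q ⊗ₜ[ℂ] d q)
    (hΔc : Δ (c q) = c q ⊗ₜ[ℂ] a q + d q ⊗ₜ[ℂ] c q)
    (hΔd : Δ (d q) = c q ⊗ₜ[ℂ] b q + d q ⊗ₜ[ℂ] d q)
    (h : A q →ₗ[ℂ] ℂ) (hh : IsHaarState Δ h) :
    h ((-(q : ℂ)) • (b q * c q)) =
      (1 - (q : ℂ) ^ (-2 : ℤ)) / (1 - (q : ℂ) ^ (-4 : ℤ)) := by
  have hq : (q : ℂ) ≠ 0 := by exact_mod_cast hq0.ne'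
  have hinv := hh.2.1 (b q * c q)
  rw [map_mul, hΔb, hΔc] at hinv
  simp only [add_mul, mul_add, Algebra.TensorProduct.tmul_mul_tmul, map_add,
    LinearMap.lTensor_tmul, TensorProduct.rid_tmul] at hinv
  rw [a_mul_d, d_mul_a, map_add, map_smul, hh.1] at hinv
  have hzero : 1 + ((q : ℂ) + (q : ℂ)⁻¹) * h (b q * c q) = 0 := by
    refine coeff_bc_eq_zero hq0.ne' (r := h (b q * a q)) (s := h (d q * c q)) ?_
    rw [← sub_eq_zero] at hinv
    rw [← hinv, smul_eq_mul]
    module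
  have hsq : (1 : ℂ) + (q : ℂ) ^ 2 ≠ 0 := by
    have : (1 : ℝ) + q ^ 2 ≠ 0 := by positivity
    exact_mod_cast this
  have hsub : (q : ℂ) ^ 2 - 1 ≠ 0 := by
    have : q ^ 2 - 1 ≠ 0 := by nlinarith
    exact_mod_cast this
  have hden : (q : ℂ) ^ 4 - 1 ≠ 0 := by
    rw [show (q : ℂ) ^ 4 - 1 = (q ^ 2 - 1) * (1 + q ^ 2) by ring]
    exact mul_ne_zero hsub hsq
  have hden' : 1 - (q : ℂ) ^ (-4 : ℤ) ≠ 0 := by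
    rw [show 1 - (q : ℂ) ^ (-4 : ℤ) = (q ^ 4 - 1) / q ^ 4 by
      rw [zpow_neg]; norm_cast; field_simp]
    exact div_ne_zero hden (pow_ne_zero _ hq)
  rw [map_smul, smul_eq_mul, eq_div_iff hden']
  have hpow2 : (q : ℂ) ^ (-2 : ℤ) = ((q : ℂ) ^ 2)⁻¹ := by rw [zpow_neg]; rfl
  have hpow4 : (q : ℂ) ^ (-4 : ℤ) = ((q : ℂ) ^ 4)⁻¹ := by rw [zpow_neg]; rfl
  rw [hpow2, hpow4]
  field_simp at hzero ⊢
  linear_combination (1 - (q : ℂ) ^ 2) * hzero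

end SLq2
end
end

section
/- The algebra O(SL_q(N)) is the internal direct sum, as a ℂ-vector space, of the subspaces A[α,β] over all pairs (α,β) ∈ M × M; moreover A[α,β]·A[α',β'] ⊆ A[α+α', β+β'] and u_{ij} ∈ A[ē_i, ē_j] for all i, j, where ē_k denotes the class of the k-th standard basis vector in M. -/
open scoped TensorProduct

noncomputable section

namespace SLqN

/-- Free algebra on the generators `u_{ij}`, `1 ≤ i,j ≤ N`. -/
abbrev F (N : ℕ) : Type := FreeAlgebra ℂ (Fin N × Fin N)

/-- The generators of the free algebra. -/
def X {N : ℕ} (i j : Fin N) : F N := FreeAlgebra.ι ℂ (i, j)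

/-- The number of inversions `ℓ(σ)` of a permutation `σ`. -/
def inversions {N : ℕ} (σ : Equiv.Perm (Fin N)) : ℕ :=
  (Finset.univ.filter (fun p : Fin N × Fin N => p.1 < p.2 ∧ σ p.2 < σ p.1)).card

/-- The quantum determinant `∑_{σ} (−q)^{ℓ(σ)} u_{1σ(1)} ⋯ u_{Nσ(N)}`. -/
def qdet (q : ℝ) (N : ℕ) : F N :=
  ∑ σ : Equiv.Perm (Fin N),
    (-(q : ℂ)) ^ inversions σ • (List.ofFn (fun i : Fin N => X i (σ i))).prod

/-- The defining relations of `O(SL_q(N))`. -/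
inductive Rel (q : ℝ) (N : ℕ) : F N → F N → Prop
  | col {i k : Fin N} (j : Fin N) : i < k →
      Rel q N (X i j * X k j) ((q : ℂ) • (X k j * X i j))
  | row (i : Fin N) {j l : Fin N} : j < l →
      Rel q N (X i j * X i l) ((q : ℂ) • (X i l * X i j))
  | comm {i k j l : Fin N} : i < k → j < l →
      Rel q N (X i l * X k j) (X k j * X i l)
  | cross {i k j l : Fin N} : i < k → j < l →
      Rel q N (X i j * X k l - X k l * X i j)
        (((q : ℂ) - (q : ℂ)⁻¹) • (X i l * X k j))
  | det : Rel q N (qdet q N) 1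

/-- `O(SL_q(N))`, the universal `ℂ`-algebra on the `u_{ij}` with the above relations. -/
abbrev A (q : ℝ) (N : ℕ) : Type := RingQuot (Rel q N)

/-- The generators `u_{ij}` of `O(SL_q(N))`. -/
def u (q : ℝ) {N : ℕ} (i j : Fin N) : A q N := RingQuot.mkAlgHom ℂ (Rel q N) (X i j)

/-- The group `M = ℤᴺ/ℤ(1,…,1)`. -/
abbrev M (N : ℕ) : Type := (Fin N → ℤ) ⧸ AddSubgroup.zmultiples (fun _ : Fin N => (1 : ℤ))

/-- The class `ē_j ∈ M` of the `j`-th standard basis vector. -/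
def e {N : ℕ} (j : Fin N) : M N := QuotientAddGroup.mk (Pi.single j 1)

/-- `z^α`, the canonical basis element of the group algebra `ℂ[M]`. -/
def z {N : ℕ} (α : M N) : AddMonoidAlgebra ℂ (M N) := AddMonoidAlgebra.single α 1

variable {q : ℝ} {N : ℕ}

/-- `L_K = (φ ⊗ id) ∘ Δ`. -/
def LK (Δ : A q N →ₐ[ℂ] A q N ⊗[ℂ] A q N)
    (φ : A q N →ₐ[ℂ] AddMonoidAlgebra ℂ (M N)) :
    A q N →ₗ[ℂ] AddMonoidAlgebra ℂ (M N) ⊗[ℂ] A q N :=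
  (TensorProduct.map φ.toLinearMap LinearMap.id).comp Δ.toLinearMap

/-- `R_K = (id ⊗ φ) ∘ Δ`. -/
def RK (Δ : A q N →ₐ[ℂ] A q N ⊗[ℂ] A q N)
    (φ : A q N →ₐ[ℂ] AddMonoidAlgebra ℂ (M N)) :
    A q N →ₗ[ℂ] A q N ⊗[ℂ] AddMonoidAlgebra ℂ (M N) :=
  (TensorProduct.map LinearMap.id φ.toLinearMap).comp Δ.toLinearMap

/-- The subspace `A[α,β] = {x | L_K x = z^α ⊗ x, R_K x = x ⊗ z^β}`. -/
def Asub (Δ : A q N →ₐ[ℂ] A q N ⊗[ℂ] A q N)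
    (φ : A q N →ₐ[ℂ] AddMonoidAlgebra ℂ (M N)) (α β : M N) : Submodule ℂ (A q N) where
  carrier := {x | LK Δ φ x = z α ⊗ₜ[ℂ] x ∧ RK Δ φ x = x ⊗ₜ[ℂ] z β}
  add_mem' := by
    rintro x y ⟨hx1, hx2⟩ ⟨hy1, hy2⟩
    exact ⟨by simp [map_add, hx1, hy1, TensorProduct.tmul_add],
           by simp [map_add, hx2, hy2, TensorProduct.add_tmul]⟩
  zero_mem' := ⟨by simp, by simp⟩
  smul_mem' := by
    rintro t x ⟨h1, h2⟩
    exact ⟨by simp [map_smul, h1, TensorProduct.tmul_smul],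
           by simp [map_smul, h2, TensorProduct.smul_tmul']⟩

/-- `h` is a Haar state: `h(1) = 1`, `(id ⊗ h)(Δ x) = h(x)·1` and `(h ⊗ id)(Δ x) = h(x)·1`. -/
def IsHaarState (Δ : A q N →ₐ[ℂ] A q N ⊗[ℂ] A q N) (h : A q N →ₗ[ℂ] ℂ) : Prop :=
  h 1 = 1 ∧
  (∀ x : A q N, (TensorProduct.rid ℂ (A q N)) ((LinearMap.lTensor (A q N) h) (Δ x)) = h x • 1) ∧
  (∀ x : A q N, (TensorProduct.lid ℂ (A q N)) ((LinearMap.rTensor (A q N) h) (Δ x)) = h x • 1)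

/-- `S` is an antipode for `Δ` and `ε`:
`m ∘ (S ⊗ id) ∘ Δ = ε(·)·1 = m ∘ (id ⊗ S) ∘ Δ`. -/
def IsAntipode (Δ : A q N →ₐ[ℂ] A q N ⊗[ℂ] A q N) (ε : A q N →ₐ[ℂ] ℂ)
    (S : A q N →ₗ[ℂ] A q N) : Prop :=
  (∀ x : A q N, LinearMap.mul' ℂ (A q N) (LinearMap.rTensor (A q N) S (Δ x)) = ε x • 1) ∧
  (∀ x : A q N, LinearMap.mul' ℂ (A q N) (LinearMap.lTensor (A q N) S (Δ x)) = ε x • 1)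
/-- The left coaction `LK` as an algebra homomorphism. -/
def leftCoaction (Δ : A q N →ₐ[ℂ] A q N ⊗[ℂ] A q N)
    (φ : A q N →ₐ[ℂ] AddMonoidAlgebra ℂ (M N)) :
    A q N →ₐ[ℂ] AddMonoidAlgebra ℂ (M N) ⊗[ℂ] A q N :=
  (Algebra.TensorProduct.map φ (AlgHom.id ℂ (A q N))).comp Δ

/-- The right coaction `RK` as an algebra homomorphism. -/
def rightCoaction (Δ : A q N →ₐ[ℂ] A q N ⊗[ℂ] A q N)
    (φ : A q N →ₐ[ℂ] AddMonoidAlgebra ℂ (M N)) :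
    A q N →ₐ[ℂ] A q N ⊗[ℂ] AddMonoidAlgebra ℂ (M N) :=
  (Algebra.TensorProduct.map (AlgHom.id ℂ (A q N)) φ).comp Δ

theorem mem_Asub_iff {Δ : A q N →ₐ[ℂ] A q N ⊗[ℂ] A q N}
    {φ : A q N →ₐ[ℂ] AddMonoidAlgebra ℂ (M N)} {α β : M N} {x : A q N} :
    x ∈ Asub Δ φ α β ↔
      leftCoaction Δ φ x = z α ⊗ₜ[ℂ] x ∧ rightCoaction Δ φ x = x ⊗ₜ[ℂ] z β :=
  Iff.rfl

theorem z_mul_z (α β : M N) : z α * z β = z (α + β) := by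
  simp [z, AddMonoidAlgebra.single_mul_single]

theorem one_mem_Asub (Δ : A q N →ₐ[ℂ] A q N ⊗[ℂ] A q N)
    (φ : A q N →ₐ[ℂ] AddMonoidAlgebra ℂ (M N)) : (1 : A q N) ∈ Asub Δ φ 0 0 := by
  rw [mem_Asub_iff, map_one, map_one]
  exact ⟨rfl, rfl⟩

theorem mul_mem_Asub {Δ : A q N →ₐ[ℂ] A q N ⊗[ℂ] A q N}
    {φ : A q N →ₐ[ℂ] AddMonoidAlgebra ℂ (M N)} {α β α' β' : M N} {x y : A q N}
    (hx : x ∈ Asub Δ φ α β) (hy : y ∈ Asub Δ φ α' β') :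
    x * y ∈ Asub Δ φ (α + α') (β + β') := by
  rw [mem_Asub_iff] at *
  rw [map_mul, map_mul, hx.1, hx.2, hy.1, hy.2, Algebra.TensorProduct.tmul_mul_tmul,
    Algebra.TensorProduct.tmul_mul_tmul, z_mul_z, z_mul_z]
  exact ⟨rfl, rfl⟩

theorem u_mem_Asub {Δ : A q N →ₐ[ℂ] A q N ⊗[ℂ] A q N}
    (hΔ : ∀ i j : Fin N, Δ (u q i j) = ∑ k : Fin N, u q i k ⊗ₜ[ℂ] u q k j)
    {φ : A q N →ₐ[ℂ] AddMonoidAlgebra ℂ (M N)}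
    (hφ : ∀ i j : Fin N, φ (u q i j) = if i = j then z (e j) else 0) (i j : Fin N) :
    u q i j ∈ Asub Δ φ (e i) (e j) := by
  rw [mem_Asub_iff]
  simp [leftCoaction, rightCoaction, hΔ, hφ, TensorProduct.ite_tmul, TensorProduct.tmul_ite]

/-- The generators `u_{ij}` generate `O(SL_q(N))` as an algebra. -/
theorem adjoin_range_u (q : ℝ) (N : ℕ) :
    Algebra.adjoin ℂ (Set.range fun p : Fin N × Fin N => u q p.1 p.2) = ⊤ := by
  have h := congrArg (Subalgebra.map (RingQuot.mkAlgHom ℂ (Rel q N)))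
    (FreeAlgebra.adjoin_range_ι (R := ℂ) (X := Fin N × Fin N))
  rw [AlgHom.map_adjoin, ← Set.range_comp, Algebra.map_top,
    (AlgHom.range_eq_top _).2 (RingQuot.mkAlgHom_surjective ℂ (Rel q N))] at h
  exact h

theorem iSup_Asub_eq_top {Δ : A q N →ₐ[ℂ] A q N ⊗[ℂ] A q N}
    (hΔ : ∀ i j : Fin N, Δ (u q i j) = ∑ k : Fin N, u q i k ⊗ₜ[ℂ] u q k j)
    {φ : A q N →ₐ[ℂ] AddMonoidAlgebra ℂ (M N)}
    (hφ : ∀ i j : Fin N, φ (u q i j) = if i = j then z (e j) else 0) :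
    ⨆ p : M N × M N, Asub Δ φ p.1 p.2 = ⊤ := by
  rw [eq_top_iff, ← Algebra.top_toSubmodule, ← adjoin_range_u, Algebra.adjoin_eq_span,
    Submodule.span_le]
  intro x hx
  obtain ⟨p, hp⟩ : ∃ p : M N × M N, x ∈ Asub Δ φ p.1 p.2 := by
    induction hx using Submonoid.closure_induction with
    | mem x hx =>
      obtain ⟨p, rfl⟩ := hx
      exact ⟨(e p.1, e p.2), u_mem_Asub hΔ hφ p.1 p.2⟩
    | one => exact ⟨0, one_mem_Asub Δ φ⟩
    | mul x y _ _ hx hy =>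
      obtain ⟨p, hp⟩ := hx
      obtain ⟨r, hr⟩ := hy
      exact ⟨p + r, mul_mem_Asub hp hr⟩
  exact Submodule.mem_iSup_of_mem p hp

/-- The linear functional on `ℂ[M]` reading off the coefficient of `z^α`. -/
def coeffAt (α : M N) : AddMonoidAlgebra ℂ (M N) →ₗ[ℂ] ℂ :=
  Finsupp.lapply α ∘ₗ (AddMonoidAlgebra.coeffLinearEquiv ℂ).toLinearMap

open scoped Classical in
theorem coeffAt_z (α β : M N) : coeffAt α (z β) = if β = α then 1 else 0 := by
  simp [coeffAt, z, Finsupp.single_apply]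

/-- The projection of `O(SL_q(N))` onto `A[α,β]`. -/
def bidegreeProj (Δ : A q N →ₐ[ℂ] A q N ⊗[ℂ] A q N)
    (φ : A q N →ₐ[ℂ] AddMonoidAlgebra ℂ (M N)) (α β : M N) : A q N →ₗ[ℂ] A q N :=
  (TensorProduct.rid ℂ (A q N)).toLinearMap ∘ₗ (coeffAt β).lTensor (A q N) ∘ₗ RK Δ φ ∘ₗ
    (TensorProduct.lid ℂ (A q N)).toLinearMap ∘ₗ (coeffAt α).rTensor (A q N) ∘ₗ LK Δ φ

open scoped Classical in
theorem bidegreeProj_apply_of_mem {Δ : A q N →ₐ[ℂ] A q N ⊗[ℂ] A q N}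
    {φ : A q N →ₐ[ℂ] AddMonoidAlgebra ℂ (M N)} {p : M N × M N} {x : A q N}
    (hx : x ∈ Asub Δ φ p.1 p.2) (r : M N × M N) :
    bidegreeProj Δ φ r.1 r.2 x = if p = r then x else 0 := by
  have hL : LK Δ φ x = z p.1 ⊗ₜ[ℂ] x := hx.1
  have hR : RK Δ φ x = x ⊗ₜ[ℂ] z p.2 := hx.2
  by_cases h₁ : p.1 = r.1 <;> by_cases h₂ : p.2 = r.2 <;>
    simp [bidegreeProj, hL, hR, coeffAt_z, Prod.ext_iff, h₁, h₂]

theorem bidegreeProj_coeAddMonoidHom [DecidableEq (M N × M N)]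
    (Δ : A q N →ₐ[ℂ] A q N ⊗[ℂ] A q N) (φ : A q N →ₐ[ℂ] AddMonoidAlgebra ℂ (M N))
    (x : DirectSum (M N × M N) fun p => Asub Δ φ p.1 p.2) (r : M N × M N) :
    bidegreeProj Δ φ r.1 r.2
      (DirectSum.coeAddMonoidHom (fun p : M N × M N => Asub Δ φ p.1 p.2) x) = x r := by
  induction x using DirectSum.induction_on with
  | zero => simp
  | of p x =>
    rw [DirectSum.coeAddMonoidHom_of, bidegreeProj_apply_of_mem x.2]
    split_ifs with h
    · subst h
      rw [DirectSum.of_eq_same]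
    · rw [DirectSum.of_eq_of_ne _ _ _ (Ne.symm h), ZeroMemClass.coe_zero]
  | add x y hx hy => rw [map_add, map_add, hx, hy, DirectSum.add_apply, Submodule.coe_add]

theorem isInternal_Asub [DecidableEq (M N × M N)] {Δ : A q N →ₐ[ℂ] A q N ⊗[ℂ] A q N}
    (hΔ : ∀ i j : Fin N, Δ (u q i j) = ∑ k : Fin N, u q i k ⊗ₜ[ℂ] u q k j)
    {φ : A q N →ₐ[ℂ] AddMonoidAlgebra ℂ (M N)}
    (hφ : ∀ i j : Fin N, φ (u q i j) = if i = j then z (e j) else 0) :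
    DirectSum.IsInternal (fun p : M N × M N => Asub Δ φ p.1 p.2) := by
  constructor
  · intro x y hxy
    refine DFinsupp.ext fun r => Subtype.ext ?_
    rw [← bidegreeProj_coeAddMonoidHom, ← bidegreeProj_coeAddMonoidHom, hxy]
  · have h := iSup_Asub_eq_top hΔ hφ
    rw [Submodule.iSup_eq_range_dfinsupp_lsum, LinearMap.range_eq_top] at h
    exact h

open scoped Classical in
/-- `O(SL_q(N))` is the internal direct sum of the subspaces
`A[α,β]` over `(α,β) ∈ M × M`; moreover `A[α,β]·A[α',β'] ⊆ A[α+α',β+β']` and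
`u_{ij} ∈ A[ē_i, ē_j]`. -/
theorem slqN_peter_weyl (q : ℝ) (hq0 : 0 < q) (hq1 : q < 1) (N : ℕ) (hN : 2 ≤ N)
    (Δ : A q N →ₐ[ℂ] A q N ⊗[ℂ] A q N)
    (hΔ : ∀ i j : Fin N, Δ (u q i j) = ∑ k : Fin N, u q i k ⊗ₜ[ℂ] u q k j)
    (φ : A q N →ₐ[ℂ] AddMonoidAlgebra ℂ (M N))
    (hφ : ∀ i j : Fin N, φ (u q i j) = if i = j then z (e j) else 0) :
    DirectSum.IsInternal (fun p : M N × M N => Asub Δ φ p.1 p.2) ∧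
    (∀ (α β α' β' : M N) (x y : A q N), x ∈ Asub Δ φ α β → y ∈ Asub Δ φ α' β' →
      x * y ∈ Asub Δ φ (α + α') (β + β')) ∧
    (∀ i j : Fin N, u q i j ∈ Asub Δ φ (e i) (e j)) := by
  exact ⟨isInternal_Asub hΔ hφ, fun _ _ _ _ _ _ => mul_mem_Asub, u_mem_Asub hΔ hφ⟩

end SLqN
end
end

section
/- Let h be a Haar state on O(SL_q(N)) and S the antipode. Then for every j with 1 ≤ j ≤ N, h(S(u_{j1}) u_{1j}) = q^{N−1}/[N]_q (i.e., h(u_{1j}* u_{1j}) = q^{N−1}/[N]_q for the SU_q(N) *-structure). -/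
open scoped TensorProduct

noncomputable section

namespace SLqN

variable {q : ℝ} {N : ℕ}

/-- The weights `q`, `q⁻¹` at the positions `s`, `t` and `1` elsewhere. -/
def weight (q : ℝ) {N : ℕ} (s t k : Fin N) : ℂ :=
  if k = s then (q : ℂ) else if k = t then (q : ℂ)⁻¹ else 1

/-- Images of the generators under the two-dimensional upper triangular representation
attached to the adjacent pair of indices `s`, `t`. -/
def triGen (q : ℝ) {N : ℕ} (s t i j : Fin N) : Matrix (Fin 2) (Fin 2) ℂ :=
  if i = j then !![weight q s t i, 0; 0, 1] else if i = s ∧ j = t then !![0, 1; 0, 0] else 0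

lemma triGen_of_lt (q : ℝ) {N : ℕ} {s t : Fin N} (hst : s.val + 1 = t.val) {i j : Fin N}
    (hij : j < i) : triGen q s t i j = 0 := by
  rw [triGen, if_neg hij.ne', if_neg]
  rintro ⟨rfl, rfl⟩
  rw [Fin.lt_def] at hij
  omega

lemma prod_weight {q : ℝ} (hq : q ≠ 0) {N : ℕ} {s t : Fin N} (hst : s ≠ t) :
    ∏ k, weight q s t k = 1 := by
  have hw : ∀ k, weight q s t k =
      (if k = s then (q : ℂ) else 1) * (if k = t then (q : ℂ)⁻¹ else 1) := by
    intro k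
    unfold weight
    split_ifs with h1 h2 <;> simp_all
  simp_rw [hw]
  rw [Finset.prod_mul_distrib]
  simp [hq]

lemma list_prod_upper (l : List ℂ) :
    (l.map fun a => (!![a, 0; 0, 1] : Matrix (Fin 2) (Fin 2) ℂ)).prod = !![l.prod, 0; 0, 1] := by
  induction l with
  | nil => simp [Matrix.one_fin_two]
  | cons a l ih => simp [ih]

lemma exists_apply_lt {N : ℕ} {σ : Equiv.Perm (Fin N)} (hσ : σ ≠ 1) : ∃ i, σ i < i := by
  by_contra! hcon
  apply hσ
  have hsum : ∑ i, (σ i : ℕ) = ∑ i : Fin N, (i : ℕ) := Equiv.sum_comp σ (fun i => (i : ℕ))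
  have := (Finset.sum_eq_sum_iff_of_le (fun i _ => Fin.le_def.mp (hcon i))).mp hsum.symm
  ext i
  exact (this i (Finset.mem_univ i)).symm

lemma lift_qdet {q : ℝ} (hq : q ≠ 0) {N : ℕ} {s t : Fin N} (hst : s.val + 1 = t.val) :
    FreeAlgebra.lift ℂ (fun p : Fin N × Fin N => triGen q s t p.1 p.2) (qdet q N) = 1 := by
  have hne : s ≠ t := by rintro rfl; omega
  rw [qdet, map_sum, Finset.sum_eq_single 1]
  · have hinv : inversions (1 : Equiv.Perm (Fin N)) = 0 := by
      rw [inversions, Finset.card_eq_zero, Finset.filter_eq_empty_iff]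
      rintro p - ⟨h1, h2⟩
      exact lt_asymm h1 h2
    rw [hinv, pow_zero, one_smul, map_list_prod, List.map_ofFn]
    have : (List.ofFn fun i : Fin N => weight q s t i).map
        (fun a => (!![a, 0; 0, 1] : Matrix (Fin 2) (Fin 2) ℂ)) =
        List.ofFn (⇑(FreeAlgebra.lift ℂ (fun p : Fin N × Fin N => triGen q s t p.1 p.2)) ∘
          fun i : Fin N => X i ((1 : Equiv.Perm (Fin N)) i)) := by
      rw [List.map_ofFn]
      congr 1
      funext i
      simp [X, triGen]
    rw [← this, list_prod_upper, List.prod_ofFn, prod_weight hq hne, Matrix.one_fin_two]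
  · intro σ _ hσ
    obtain ⟨i, hi⟩ := exists_apply_lt hσ
    rw [map_smul, map_list_prod, List.map_ofFn, List.prod_eq_zero, smul_zero]
    rw [List.mem_ofFn]
    exact ⟨i, by simpa [X] using triGen_of_lt q hst hi⟩
  · simp

lemma triGen_rel {q : ℝ} (hq : q ≠ 0) {N : ℕ} {s t : Fin N} (hst : s.val + 1 = t.val)
    {x y : F N} (hxy : Rel q N x y) :
    FreeAlgebra.lift ℂ (fun p : Fin N × Fin N => triGen q s t p.1 p.2) x =
      FreeAlgebra.lift ℂ (fun p : Fin N × Fin N => triGen q s t p.1 p.2) y := by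
  have hqc : (q : ℂ) ≠ 0 := by exact_mod_cast hq
  have hne : s ≠ t := by rintro rfl; omega
  cases hxy with
  | @col i k j hik =>
    simp only [map_mul, map_smul, X, FreeAlgebra.lift_ι_apply]
    simp only [Fin.ext_iff, Fin.lt_def, triGen] at *
    split_ifs <;> first
      | (exfalso; omega)
      | (simp; done)
      | (ext a b; fin_cases a <;> fin_cases b <;> simp <;> grind [weight])
  | @row i j l hjl =>
    simp only [map_mul, map_smul, X, FreeAlgebra.lift_ι_apply]
    simp only [Fin.ext_iff, Fin.lt_def, triGen] at *
    split_ifs <;> first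
      | (exfalso; omega)
      | (simp; done)
      | (ext a b; fin_cases a <;> fin_cases b <;> simp <;> grind [weight])
  | @comm i k j l hik hjl =>
    simp only [map_mul, X, FreeAlgebra.lift_ι_apply]
    simp only [Fin.ext_iff, Fin.lt_def, triGen] at *
    split_ifs <;> first
      | (exfalso; omega)
      | simp
  | @cross i k j l hik hjl =>
    simp only [map_mul, map_sub, map_smul, X, FreeAlgebra.lift_ι_apply]
    simp only [Fin.ext_iff, Fin.lt_def, triGen] at *
    split_ifs <;> first
      | (exfalso; omega)
      | (simp; done)
      | (ext a b; fin_cases a <;> fin_cases b <;> simp <;> grind [weight])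
  | det => rw [lift_qdet hq hst, map_one]

/-- The two-dimensional upper triangular representation of `O(SL_q(N))` attached to the
adjacent pair of indices `s`, `t`. -/
def triRep {q : ℝ} (hq : q ≠ 0) {N : ℕ} {s t : Fin N} (hst : s.val + 1 = t.val) :
    A q N →ₐ[ℂ] Matrix (Fin 2) (Fin 2) ℂ :=
  RingQuot.liftAlgHom ℂ ⟨FreeAlgebra.lift ℂ fun p : Fin N × Fin N => triGen q s t p.1 p.2,
    fun _ _ hxy => triGen_rel hq hst hxy⟩

lemma triRep_u {q : ℝ} (hq : q ≠ 0) {N : ℕ} {s t : Fin N} (hst : s.val + 1 = t.val)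
    (i j : Fin N) : triRep hq hst (u q i j) = triGen q s t i j := by
  simp [triRep, u, X]

section Antipode

variable {Δ : A q N →ₐ[ℂ] A q N ⊗[ℂ] A q N} {ε : A q N →ₐ[ℂ] ℂ} {S : A q N →ₗ[ℂ] A q N}

lemma sum_antipode_mul (hΔ : ∀ i j : Fin N, Δ (u q i j) = ∑ k : Fin N, u q i k ⊗ₜ[ℂ] u q k j)
    (hε : ∀ i j : Fin N, ε (u q i j) = if i = j then 1 else 0) (hS : IsAntipode Δ ε S)
    (i j : Fin N) : ∑ k, S (u q i k) * u q k j = if i = j then 1 else 0 := by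
  have := hS.1 (u q i j)
  simpa [hΔ, hε] using this

lemma sum_mul_antipode (hΔ : ∀ i j : Fin N, Δ (u q i j) = ∑ k : Fin N, u q i k ⊗ₜ[ℂ] u q k j)
    (hε : ∀ i j : Fin N, ε (u q i j) = if i = j then 1 else 0) (hS : IsAntipode Δ ε S)
    (i j : Fin N) : ∑ k, u q i k * S (u q k j) = if i = j then 1 else 0 := by
  have := hS.2 (u q i j)
  simpa [hΔ, hε] using this

lemma comul_antipode (hΔ : ∀ i j : Fin N, Δ (u q i j) = ∑ k : Fin N, u q i k ⊗ₜ[ℂ] u q k j)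
    (hε : ∀ i j : Fin N, ε (u q i j) = if i = j then 1 else 0) (hS : IsAntipode Δ ε S)
    (i j : Fin N) : Δ (S (u q i j)) = ∑ m, S (u q m j) ⊗ₜ[ℂ] S (u q i m) := by
  have h1 : (Matrix.of fun i j => Δ (S (u q i j))) * (Matrix.of fun i j : Fin N => Δ (u q i j))
      = 1 := by
    ext i j
    simp only [Matrix.mul_apply, Matrix.of_apply, ← map_mul, ← map_sum,
      sum_antipode_mul hΔ hε hS, Matrix.one_apply]
    split_ifs <;> simp
  have h2 : (Matrix.of fun i j : Fin N => Δ (u q i j)) *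
      (Matrix.of fun i j => ∑ m, S (u q m j) ⊗ₜ[ℂ] S (u q i m)) = 1 := by
    ext i j
    simp only [Matrix.mul_apply, Matrix.of_apply, hΔ, Finset.sum_mul_sum,
      Algebra.TensorProduct.tmul_mul_tmul, Matrix.one_apply]
    rw [Finset.sum_comm]
    have : ∀ p m : Fin N, ∑ k, (u q i p * S (u q m j)) ⊗ₜ[ℂ] (u q p k * S (u q k m)) =
        if p = m then (u q i p * S (u q m j)) ⊗ₜ[ℂ] (1 : A q N) else 0 := by
      intro p m
      rw [← TensorProduct.tmul_sum, sum_mul_antipode hΔ hε hS]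
      split_ifs <;> simp
    calc _ = ∑ p, ∑ m, ∑ k, (u q i p * S (u q m j)) ⊗ₜ[ℂ] (u q p k * S (u q k m)) :=
          Finset.sum_congr rfl fun p _ => Finset.sum_comm
      _ = (∑ p, u q i p * S (u q p j)) ⊗ₜ[ℂ] (1 : A q N) := by
          simp [this, TensorProduct.sum_tmul]
      _ = _ := by
          rw [sum_mul_antipode hΔ hε hS]
          split_ifs <;> simp [Algebra.TensorProduct.one_def]
  exact congrArg (fun B : Matrix (Fin N) (Fin N) (A q N ⊗[ℂ] A q N) => B i j)
    (left_inv_eq_right_inv h1 h2)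

lemma haar_invariance (hΔ : ∀ i j : Fin N, Δ (u q i j) = ∑ k : Fin N, u q i k ⊗ₜ[ℂ] u q k j)
    (hε : ∀ i j : Fin N, ε (u q i j) = if i = j then 1 else 0) (hS : IsAntipode Δ ε S)
    {h : A q N →ₗ[ℂ] ℂ} (hh : IsHaarState Δ h) (i j k l : Fin N) :
    ∑ m, ∑ p, h (S (u q i m) * u q p l) • (S (u q m j) * u q k p) =
      h (S (u q i j) * u q k l) • 1 := by
  have := hh.2.1 (S (u q i j) * u q k l)
  rw [map_mul, comul_antipode hΔ hε hS, hΔ, Finset.sum_mul_sum] at this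
  simpa using this

lemma triRep_antipode (hΔ : ∀ i j : Fin N, Δ (u q i j) = ∑ k : Fin N, u q i k ⊗ₜ[ℂ] u q k j)
    (hε : ∀ i j : Fin N, ε (u q i j) = if i = j then 1 else 0) (hS : IsAntipode Δ ε S)
    (hq : q ≠ 0) {s t : Fin N} (hst : s.val + 1 = t.val) (m : Fin N) :
    triRep hq hst (S (u q m t)) =
      if m = t then !![(q : ℂ), 0; 0, 1] else if m = s then !![0, -(q : ℂ)⁻¹; 0, 0] else 0 := by
  have hqc : (q : ℂ) ≠ 0 := by exact_mod_cast hq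
  have hne : s ≠ t := by rintro rfl; omega
  have key : ∀ j, ∑ k, triRep hq hst (S (u q m k)) * triGen q s t k j =
      if m = j then 1 else 0 := by
    intro j
    have := congrArg (triRep hq hst) (sum_antipode_mul hΔ hε hS m j)
    simp only [map_sum, map_mul, triRep_u] at this
    rw [this]
    split_ifs <;> simp
  have hs : triRep hq hst (S (u q m s)) * !![(q : ℂ), 0; 0, 1] = if m = s then 1 else 0 := by
    rw [← key s, Finset.sum_eq_single s]
    · simp [triGen, weight]
    · intro k _ hk
      simp [triGen, hk, hne]
    · simp
  have ht : triRep hq hst (S (u q m t)) * !![(q : ℂ)⁻¹, 0; 0, 1] +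
      triRep hq hst (S (u q m s)) * !![0, 1; 0, 0] = if m = t then 1 else 0 := by
    rw [← key t, Finset.sum_eq_add t s hne.symm]
    · simp [triGen, weight, hne, hne.symm]
    · intro k _ hk
      simp [triGen, hk.1, hk.2]
    · simp
    · simp
  have hs' : triRep hq hst (S (u q m s)) =
      (if m = s then 1 else 0) * !![(q : ℂ)⁻¹, 0; 0, 1] := by
    rw [← hs, mul_assoc]
    simp [hqc, ← Matrix.one_fin_two]
  have ht' : triRep hq hst (S (u q m t)) =
      ((if m = t then 1 else 0) - triRep hq hst (S (u q m s)) * !![0, 1; 0, 0]) *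
        !![(q : ℂ), 0; 0, 1] := by
    rw [← ht, add_sub_cancel_right, mul_assoc]
    simp [hqc, ← Matrix.one_fin_two]
  rw [ht', hs']
  split_ifs with h1 h2
  · exact absurd (h2.symm.trans h1) hne
  all_goals
    ext a b
    fin_cases a <;> fin_cases b <;> simp

lemma haar_adjacent (hΔ : ∀ i j : Fin N, Δ (u q i j) = ∑ k : Fin N, u q i k ⊗ₜ[ℂ] u q k j)
    (hε : ∀ i j : Fin N, ε (u q i j) = if i = j then 1 else 0) (hS : IsAntipode Δ ε S)
    {h : A q N →ₗ[ℂ] ℂ} (hh : IsHaarState Δ h) (hq : q ≠ 0) (i : Fin N) {s t : Fin N}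
    (hst : s.val + 1 = t.val) :
    (q : ℂ) * h (S (u q i t) * u q t i) = (q : ℂ)⁻¹ * h (S (u q i s) * u q s i) := by
  have hne : s ≠ t := by rintro rfl; omega
  have hinv := congrArg (triRep hq hst) (haar_invariance hΔ hε hS hh i t s i)
  simp only [map_sum, map_smul, map_mul, triRep_u, triRep_antipode hΔ hε hS, map_one] at hinv
  have hentry := congrFun (congrFun hinv 0) 1
  rw [Finset.sum_eq_add t s hne.symm (fun m _ hm => by simp [hm.1, hm.2]) (by simp) (by simp)]
    at hentry
  rw [Finset.sum_eq_add t s hne.symm (fun p _ hp => by simp [triGen, hp.1, hp.2.symm])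
    (by simp) (by simp)] at hentry
  rw [Finset.sum_eq_add t s hne.symm (fun p _ hp => by simp [triGen, hp.1, hp.2.symm])
    (by simp) (by simp)] at hentry
  simp [triGen, hne, weight] at hentry
  linear_combination hentry

lemma sum_haar (hΔ : ∀ i j : Fin N, Δ (u q i j) = ∑ k : Fin N, u q i k ⊗ₜ[ℂ] u q k j)
    (hε : ∀ i j : Fin N, ε (u q i j) = if i = j then 1 else 0) (hS : IsAntipode Δ ε S)
    {h : A q N →ₗ[ℂ] ℂ} (hh : IsHaarState Δ h) (i : Fin N) :
    ∑ k, h (S (u q i k) * u q k i) = 1 := by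
  rw [← map_sum, sum_antipode_mul hΔ hε hS, if_pos rfl, hh.1]

end Antipode

/-- For every `j`, `h(S(u_{j1}) u_{1j}) = q^{N−1}/[N]_q`, where
`[N]_q = q^{N−1} + q^{N−3} + ⋯ + q^{1−N}` (indices zero-based, so `u_{1j}` is `u 0 j`). -/
theorem slqN_haar_first_row (q : ℝ) (hq0 : 0 < q) (hq1 : q < 1)
    (N : ℕ) (hN : 2 ≤ N)
    (Δ : A q N →ₐ[ℂ] A q N ⊗[ℂ] A q N)
    (hΔ : ∀ i j : Fin N, Δ (u q i j) = ∑ k : Fin N, u q i k ⊗ₜ[ℂ] u q k j)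
    (ε : A q N →ₐ[ℂ] ℂ)
    (hε : ∀ i j : Fin N, ε (u q i j) = if i = j then 1 else 0)
    (S : A q N →ₗ[ℂ] A q N) (hS : IsAntipode Δ ε S)
    (h : A q N →ₗ[ℂ] ℂ) (hh : IsHaarState Δ h) :
    ∀ j : Fin N, h (S (u q j (⟨0, by omega⟩ : Fin N)) * u q (⟨0, by omega⟩ : Fin N) j) =
      (q : ℂ) ^ ((N : ℤ) - 1) / ∑ k : Fin N, (q : ℂ) ^ ((N : ℤ) - 1 - 2 * (k : ℤ)) := by
  intro j
  have hq : q ≠ 0 := hq0.ne'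
  have hqc : (q : ℂ) ≠ 0 := by exact_mod_cast hq
  set c : ℂ := h (S (u q j (⟨0, by omega⟩ : Fin N)) * u q (⟨0, by omega⟩ : Fin N) j) with hc
  have hgeom : ∀ n (hn : n < N),
      h (S (u q j ⟨n, hn⟩) * u q ⟨n, hn⟩ j) = (q : ℂ) ^ (-2 * (n : ℤ)) * c := by
    intro n
    induction n with
    | zero => intro hn; simp [hc]
    | succ n ih =>
      intro hn
      have hadj := haar_adjacent hΔ hε hS hh hq j
        (s := ⟨n, by omega⟩) (t := ⟨n + 1, hn⟩) rfl
      rw [ih] at hadj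
      have hpow : (q : ℂ) ^ (-2 * ((n + 1 : ℕ) : ℤ)) =
          (q : ℂ)⁻¹ * (q : ℂ)⁻¹ * (q : ℂ) ^ (-2 * (n : ℤ)) := by
        rw [← zpow_neg_one, ← zpow_add₀ hqc, ← zpow_add₀ hqc]
        congr 1
        push_cast
        ring
      rw [hpow]
      apply mul_left_cancel₀ hqc
      rw [hadj]
      field_simp
  have hsum : (∑ k : Fin N, (q : ℂ) ^ (-2 * ((k : ℕ) : ℤ))) * c = 1 := by
    rw [Finset.sum_mul, ← sum_haar hΔ hε hS hh j]
    exact Finset.sum_congr rfl fun k _ => (hgeom k k.isLt).symm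
  have hfactor : ∑ k : Fin N, (q : ℂ) ^ ((N : ℤ) - 1 - 2 * ((k : ℕ) : ℤ)) =
      (q : ℂ) ^ ((N : ℤ) - 1) * ∑ k : Fin N, (q : ℂ) ^ (-2 * ((k : ℕ) : ℤ)) := by
    rw [Finset.mul_sum]
    refine Finset.sum_congr rfl fun k _ => ?_
    rw [← zpow_add₀ hqc]
    exact congrArg _ (by ring)
  rw [hfactor, eq_div_iff]
  · linear_combination (q : ℂ) ^ ((N : ℤ) - 1) * hsum
  · exact mul_ne_zero (zpow_ne_zero _ hqc) (left_ne_zero_of_mul_eq_one hsum)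

end SLqN
end
end

section
/- Let h be a Haar state on O(SL_q(N)) and S the antipode. Then for all i, j with 1 ≤ i, j ≤ N: h(S(u_{ji}) u_{ij}) = q^{N+1−2i}/[N]_q and h(u_{ij} S(u_{ji})) = q^{2j−N−1}/[N]_q. (For the SU_q(N) *-structure, these are the formulas ⟨u_{ij}, u_{ij}⟩_L = h(u_{ij}*u_{ij}) = q^{−2i'}/[N]_q and ⟨u_{ij}, u_{ij}⟩_R = h(u_{ij}u_{ij}*) = q^{2j'}/[N]_q for the fundamental corepresentation, where i' = i − (N+1)/2 and j' = j − (N+1)/2.) -/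
open scoped TensorProduct

noncomputable section

namespace SLqN

variable {q : ℝ} {N : ℕ}

section Bialgebra

variable {n B : Type*} [Fintype n] [DecidableEq n] [Ring B] [Algebra ℂ B]
  {Δ : B →ₐ[ℂ] B ⊗[ℂ] B} {U V : Matrix n n B}

/-- If `U` is a corepresentation matrix with inverse `V`, then `V` is a corepresentation matrix
for the opposite comultiplication and transposed indices. -/
theorem comul_inverse_entry (hΔ : ∀ i j, Δ (U i j) = ∑ k, U i k ⊗ₜ[ℂ] U k j)
    (hVU : V * U = 1) (hUV : U * V = 1) (a b : n) :
    Δ (V a b) = ∑ k, V k b ⊗ₜ[ℂ] V a k := by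
  let l : B →ₐ[ℂ] B ⊗[ℂ] B := Algebra.TensorProduct.includeLeft
  let r : B →ₐ[ℂ] B ⊗[ℂ] B := Algebra.TensorProduct.includeRight
  have hU : U.map Δ = U.map l * U.map r := by
    ext i j
    simp [Matrix.mul_apply, hΔ, l, r]
  have h1 : V.map Δ * U.map Δ = 1 := by
    rw [← Matrix.map_mul, hVU, Matrix.map_one _ (map_zero _) (map_one _)]
  have h2 : U.map Δ * (V.map r * V.map l) = 1 := by
    have e1 : U.map r * V.map r = 1 := by
      rw [← Matrix.map_mul, hUV, Matrix.map_one _ (map_zero _) (map_one _)]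
    have e2 : U.map l * V.map l = 1 := by
      rw [← Matrix.map_mul, hUV, Matrix.map_one _ (map_zero _) (map_one _)]
    rw [hU, Matrix.mul_assoc, ← Matrix.mul_assoc (U.map r), e1, Matrix.one_mul, e2]
  have h3 := congrArg (fun W => W a b) (left_inv_eq_right_inv h1 h2)
  simpa [Matrix.mul_apply, l, r] using h3

/-- Invariance of `h` turns the values `h (V a b * U b d)` into an intertwiner of `U`. -/
theorem intertwiner_of_right_invariant (hΔ : ∀ i j, Δ (U i j) = ∑ k, U i k ⊗ₜ[ℂ] U k j)
    (hVU : V * U = 1) (hUV : U * V = 1) {h : B →ₗ[ℂ] ℂ}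
    (hh : ∀ x, TensorProduct.lid ℂ B (LinearMap.rTensor B h (Δ x)) = h x • 1) (b : n) :
    U * (Matrix.of fun a d => algebraMap ℂ B (h (V a b * U b d))) =
      (Matrix.of fun a d => algebraMap ℂ B (h (V a b * U b d))) * U := by
  set F : Matrix n n B := Matrix.of fun a d => algebraMap ℂ B (h (V a b * U b d)) with hF
  have key : V * F * U = F := by
    ext a d
    have := hh (V a b * U b d)
    rw [map_mul, comul_inverse_entry hΔ hVU hUV, hΔ, Finset.sum_mul_sum] at this
    simp only [Algebra.TensorProduct.tmul_mul_tmul, map_sum, LinearMap.rTensor_tmul,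
      TensorProduct.lid_tmul] at this
    rw [Finset.sum_comm] at this
    simp only [Matrix.mul_apply, hF, Matrix.of_apply, Finset.sum_mul, ← Algebra.commutes]
    simpa [Algebra.smul_def, mul_assoc] using this
  calc U * F = U * (V * F * U) := by rw [key]
    _ = (U * V) * F * U := by simp only [Matrix.mul_assoc]
    _ = F * U := by rw [hUV, Matrix.one_mul]

/-- Invariance of `h` turns the values `h (U a b * V b d)` into an intertwiner of `U`. -/
theorem intertwiner_of_left_invariant (hΔ : ∀ i j, Δ (U i j) = ∑ k, U i k ⊗ₜ[ℂ] U k j)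
    (hVU : V * U = 1) (hUV : U * V = 1) {h : B →ₗ[ℂ] ℂ}
    (hh : ∀ x, TensorProduct.rid ℂ B (LinearMap.lTensor B h (Δ x)) = h x • 1) (b : n) :
    U * (Matrix.of fun a d => algebraMap ℂ B (h (U a b * V b d))) =
      (Matrix.of fun a d => algebraMap ℂ B (h (U a b * V b d))) * U := by
  set F : Matrix n n B := Matrix.of fun a d => algebraMap ℂ B (h (U a b * V b d)) with hF
  have key : U * F * V = F := by
    ext a d
    have := hh (U a b * V b d)
    rw [map_mul, comul_inverse_entry hΔ hVU hUV, hΔ, Finset.sum_mul_sum] at this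
    simp only [Algebra.TensorProduct.tmul_mul_tmul, map_sum, LinearMap.lTensor_tmul,
      TensorProduct.rid_tmul] at this
    rw [Finset.sum_comm] at this
    simp only [Matrix.mul_apply, hF, Matrix.of_apply, Finset.sum_mul, ← Algebra.commutes]
    simpa [Algebra.smul_def, mul_assoc] using this
  calc U * F = U * F * (V * U) := by rw [hVU, Matrix.mul_one]
    _ = (U * F * V) * U := by simp only [Matrix.mul_assoc]
    _ = F * U := by rw [key]

end Bialgebra

section Relations

variable (q : ℝ) {N : ℕ}

theorem u_col {i k : Fin N} (j : Fin N) (hik : i < k) :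
    u q i j * u q k j = (q : ℂ) • (u q k j * u q i j) := by
  simpa only [u, map_mul, map_smul] using RingQuot.mkAlgHom_rel ℂ (Rel.col (q := q) j hik)

theorem u_row (i : Fin N) {j l : Fin N} (hjl : j < l) :
    u q i j * u q i l = (q : ℂ) • (u q i l * u q i j) := by
  simpa only [u, map_mul, map_smul] using RingQuot.mkAlgHom_rel ℂ (Rel.row (q := q) i hjl)

theorem u_comm {i k j l : Fin N} (hik : i < k) (hjl : j < l) :
    u q i l * u q k j = u q k j * u q i l := by
  simpa [u] using RingQuot.mkAlgHom_rel ℂ (Rel.comm (q := q) hik hjl)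

theorem u_cross {i k j l : Fin N} (hik : i < k) (hjl : j < l) :
    u q i j * u q k l - u q k l * u q i j =
      ((q : ℂ) - (q : ℂ)⁻¹) • (u q i l * u q k j) := by
  simpa [u] using RingQuot.mkAlgHom_rel ℂ (Rel.cross (q := q) hik hjl)

/-- The defining quadratic relations in `R`-matrix form. -/
theorem u_rtt (hq : q ≠ 0) (a b c d : Fin N) :
    (if a = b then (q : ℂ) else 1) • (u q a c * u q b d) +
        (if b < a then (q : ℂ) - (q : ℂ)⁻¹ else 0) • (u q b c * u q a d) =
      (if c = d then (q : ℂ) else 1) • (u q b d * u q a c) +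
        (if c < d then (q : ℂ) - (q : ℂ)⁻¹ else 0) • (u q b c * u q a d) := by
  have hq' : (q : ℂ) ≠ 0 := by exact_mod_cast hq
  have hqq : ((q : ℂ) - (q : ℂ)⁻¹) * q = q * q - 1 := by field_simp
  rcases lt_trichotomy a b with hab | rfl | hab <;> rcases lt_trichotomy c d with hcd | rfl | hcd
  · simp only [hab.ne, hab.not_gt, hcd.ne, hcd, if_true, if_false, one_smul, zero_smul, add_zero]
    rw [← u_comm q hab hcd, ← u_cross q hab hcd]
    abel
  · simp [hab.ne, hab.not_gt, u_col q c hab]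
  · simp [hab.ne, hab.not_gt, hcd.ne', hcd.not_gt, u_comm q hab hcd]
  · simp only [hcd.ne, hcd, lt_irrefl, if_true, if_false, zero_smul, add_zero, one_smul]
    rw [u_row q a hcd, smul_smul, smul_smul, hqq]
    module
  · simp
  · simp [hcd.ne', hcd.not_gt, u_row q a hcd]
  · simp [hab.ne', hab, hcd.ne, hcd, u_comm q hab hcd]
  · simp only [hab.ne', hab, lt_irrefl, if_true, if_false, one_smul, zero_smul, add_zero]
    rw [u_col q c hab, smul_smul, smul_smul, hqq]
    module
  · simp only [hab.ne', hab, hcd.ne', hcd.not_gt, if_true, if_false, one_smul, zero_smul, add_zero]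
    rw [← u_cross q hab hcd]
    abel

/-- The relation between the generators and the entries of the inverse matrix `V`. -/
theorem u_inverse_exchange (hq : q ≠ 0) {V : Fin N → Fin N → A q N}
    (hVU : ∀ i j, ∑ k, V i k * u q k j = if i = j then 1 else 0)
    (hUV : ∀ i j, ∑ k, u q i k * V k j = if i = j then 1 else 0) (a c : Fin N) :
    (q : ℂ) • (V c a * u q a c) +
        ((q : ℂ) - (q : ℂ)⁻¹) • ∑ k with k < a, V c k * u q k c =
      (q : ℂ) • (u q a c * V c a) +
        ((q : ℂ) - (q : ℂ)⁻¹) • ∑ k with c < k, u q a k * V k a := by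
  have key : ∑ b, ∑ d, V c b * ((if a = b then (q : ℂ) else 1) • (u q a c * u q b d) +
        (if b < a then (q : ℂ) - (q : ℂ)⁻¹ else 0) • (u q b c * u q a d)) * V d a =
      ∑ b, ∑ d, V c b * ((if c = d then (q : ℂ) else 1) • (u q b d * u q a c) +
        (if c < d then (q : ℂ) - (q : ℂ)⁻¹ else 0) • (u q b c * u q a d)) * V d a := by
    refine Finset.sum_congr rfl fun b _ => Finset.sum_congr rfl fun d _ => ?_
    rw [u_rtt q hq]
  simp only [mul_add, add_mul, Finset.sum_add_distrib] at key
  have l1 : ∑ b, ∑ d, V c b * ((if a = b then (q : ℂ) else 1) • (u q a c * u q b d)) * V d a =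
      (q : ℂ) • (V c a * u q a c) := by
    have (b d : Fin N) : V c b * ((if a = b then (q : ℂ) else 1) • (u q a c * u q b d)) * V d a =
        (if a = b then (q : ℂ) else 1) • (V c b * u q a c * (u q b d * V d a)) := by
      simp only [mul_smul_comm, smul_mul_assoc, mul_assoc]
    simp only [this, ← Finset.smul_sum, ← Finset.mul_sum, hUV]
    rw [Finset.sum_eq_single a] <;> simp +contextual [eq_comm, -Complex.coe_smul]
  have l2 : ∑ b, ∑ d, V c b * ((if b < a then (q : ℂ) - (q : ℂ)⁻¹ else 0) •
        (u q b c * u q a d)) * V d a =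
      ((q : ℂ) - (q : ℂ)⁻¹) • ∑ k with k < a, V c k * u q k c := by
    have (b d : Fin N) : V c b * ((if b < a then (q : ℂ) - (q : ℂ)⁻¹ else 0) •
          (u q b c * u q a d)) * V d a =
        (if b < a then (q : ℂ) - (q : ℂ)⁻¹ else 0) • (V c b * u q b c * (u q a d * V d a)) := by
      simp only [mul_smul_comm, smul_mul_assoc, mul_assoc]
    simp only [this, ← Finset.smul_sum, ← Finset.mul_sum, hUV]
    simp [Finset.sum_filter, Finset.smul_sum]
  have r1 : ∑ b, ∑ d, V c b * ((if c = d then (q : ℂ) else 1) • (u q b d * u q a c)) * V d a =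
      (q : ℂ) • (u q a c * V c a) := by
    have (b d : Fin N) : V c b * ((if c = d then (q : ℂ) else 1) • (u q b d * u q a c)) * V d a =
        (if c = d then (q : ℂ) else 1) • (V c b * u q b d * (u q a c * V d a)) := by
      simp only [mul_smul_comm, smul_mul_assoc, mul_assoc]
    rw [Finset.sum_comm]
    simp only [this, ← Finset.smul_sum, ← Finset.sum_mul, hVU]
    rw [Finset.sum_eq_single c] <;> simp +contextual [eq_comm, -Complex.coe_smul]
  have r2 : ∑ b, ∑ d, V c b * ((if c < d then (q : ℂ) - (q : ℂ)⁻¹ else 0) •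
        (u q b c * u q a d)) * V d a =
      ((q : ℂ) - (q : ℂ)⁻¹) • ∑ k with c < k, u q a k * V k a := by
    have (b d : Fin N) : V c b * ((if c < d then (q : ℂ) - (q : ℂ)⁻¹ else 0) •
          (u q b c * u q a d)) * V d a =
        (if c < d then (q : ℂ) - (q : ℂ)⁻¹ else 0) • (V c b * u q b c * (u q a d * V d a)) := by
      simp only [mul_smul_comm, smul_mul_assoc, mul_assoc]
    rw [Finset.sum_comm]
    simp only [this, ← Finset.smul_sum, ← Finset.sum_mul, hVU]
    simp [Finset.sum_filter, Finset.smul_sum]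
  rwa [l1, l2, r1, r2] at key

end Relations

section Geometric

variable {N : ℕ}

theorem eq_mul_pow_of_ratio {g : Fin N → ℂ} {r : ℂ}
    (hg : ∀ m n : Fin N, (m : ℕ) + 1 = n → g n = r * g m) (h0 : 0 < N) (i : Fin N) :
    g i = g ⟨0, h0⟩ * r ^ (i : ℕ) := by
  obtain ⟨i, hi⟩ := i
  induction i with
  | zero => simp
  | succ k ih => rw [hg ⟨k, by omega⟩ ⟨k + 1, hi⟩ rfl, ih]; ring

theorem eq_of_consecutive {α : Type*} {g : Fin N → α}
    (hg : ∀ m n : Fin N, (m : ℕ) + 1 = n → g n = g m) (i j : Fin N) : g i = g j := by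
  have h0 : 0 < N := i.pos
  have key : ∀ i : Fin N, g i = g ⟨0, h0⟩ := by
    rintro ⟨i, hi⟩
    induction i with
    | zero => rfl
    | succ k ih => rw [hg ⟨k, by omega⟩ ⟨k + 1, hi⟩ rfl, ih]
  rw [key i, key j]

theorem eq_div_sum_of_proportional {g w : Fin N → ℂ} {c : ℂ} (hg : ∀ i, g i = c * w i)
    (hsum : ∑ i, g i = 1) (i : Fin N) : g i = w i / ∑ k, w k := by
  simp only [hg, ← Finset.mul_sum] at hsum
  have hw : ∑ k, w k ≠ 0 := right_ne_zero_of_mul_eq_one hsum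
  rw [hg, eq_div_iff hw, mul_right_comm, hsum, one_mul]

theorem eq_inv_sq_mul_of_head_sum {q C : ℂ} (hq : q ≠ 0) {g : Fin N → ℂ}
    (hg : ∀ a, q * g a + (q - q⁻¹) * ∑ k with k < a, g k = C) {m n : Fin N}
    (hmn : (m : ℕ) + 1 = n) : g n = (q ^ 2)⁻¹ * g m := by
  have hset : (Finset.univ.filter fun k : Fin N => k < n) =
      insert m (Finset.univ.filter fun k : Fin N => k < m) := by
    ext k; simp only [Finset.mem_filter, Finset.mem_univ, true_and, Finset.mem_insert]; omega
  have h1 := hg n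
  rw [hset, Finset.sum_insert (by simp)] at h1
  have h2 : q * g n = q⁻¹ * g m := by linear_combination h1 - hg m
  field_simp at h2 ⊢
  linear_combination h2

theorem eq_sq_mul_of_tail_sum {q C : ℂ} (hq : q ≠ 0) {g : Fin N → ℂ}
    (hg : ∀ a, q * g a + (q - q⁻¹) * ∑ k with a < k, g k = C) {m n : Fin N}
    (hmn : (m : ℕ) + 1 = n) : g n = q ^ 2 * g m := by
  have hset : (Finset.univ.filter fun k : Fin N => m < k) =
      insert n (Finset.univ.filter fun k : Fin N => n < k) := by
    ext k; simp only [Finset.mem_filter, Finset.mem_univ, true_and, Finset.mem_insert]; omega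
  have h1 := hg m
  rw [hset, Finset.sum_insert (by simp)] at h1
  have h2 : q * g m = q⁻¹ * g n := by linear_combination h1 - hg n
  field_simp at h2 ⊢
  linear_combination -h2

end Geometric

section Functional

variable (q : ℝ) {N : ℕ}

/-- Diagonal entries of `triangularEntry`. -/
def triangularWeight (m n i : Fin N) : Fin 2 → ℂ :=
  ![if i = m then (q : ℂ) else if i = n then (q : ℂ)⁻¹ else 1, 1]

/-- Values on generators of a two-dimensional upper triangular representation of `O(SL_q(N))`. -/
def triangularEntry (m n i j : Fin N) : Matrix (Fin 2) (Fin 2) ℂ :=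
  if i = j then Matrix.diagonal (triangularWeight q m n i)
  else if i = m ∧ j = n then !![0, 1; 0, 0] else 0

theorem triangularEntry_self (m n i : Fin N) :
    triangularEntry q m n i i = Matrix.diagonal (triangularWeight q m n i) := by
  simp [triangularEntry]

theorem triangularEntry_edge {m n : Fin N} (hmn : m ≠ n) :
    triangularEntry q m n m n = !![0, 1; 0, 0] := by
  simp [triangularEntry, hmn]

theorem triangularEntry_eq_zero {m n i j : Fin N} (hij : i ≠ j) (h : ¬ (i = m ∧ j = n)) :
    triangularEntry q m n i j = 0 := by
  rw [triangularEntry, if_neg hij, if_neg h]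

theorem triangularEntry_of_lt {m n i j : Fin N} (hmn : m < n) (hij : j < i) :
    triangularEntry q m n i j = 0 := by
  have : ¬ (i = m ∧ j = n) := by rintro ⟨rfl, rfl⟩; exact hmn.not_gt hij
  simp [triangularEntry, hij.ne', this]

theorem inversions_one : inversions (1 : Equiv.Perm (Fin N)) = 0 := by
  simp only [inversions, Finset.card_eq_zero, Finset.filter_eq_empty_iff]
  rintro p - ⟨h1, h2⟩
  exact h1.not_gt h2

theorem exists_apply_lt_of_ne_one {σ : Equiv.Perm (Fin N)} (hσ : σ ≠ 1) : ∃ i, σ i < i := by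
  by_contra! hle
  refine hσ (Equiv.ext fun i => ?_)
  have hsum : ∑ i : Fin N, (i : ℕ) = ∑ i, (σ i : ℕ) := (Equiv.sum_comp σ fun i => (i : ℕ)).symm
  have := (Finset.sum_eq_sum_iff_of_le fun i _ => Fin.le_def.1 (hle i)).1 hsum i (Finset.mem_univ i)
  exact Fin.ext this.symm

theorem prod_triangularWeight (hq : q ≠ 0) {m n : Fin N} (hmn : m ≠ n) :
    ∏ i, triangularWeight q m n i = 1 := by
  have hq' : (q : ℂ) ≠ 0 := by exact_mod_cast hq
  ext s
  rw [Finset.prod_apply]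
  fin_cases s
  · have : ∀ i, triangularWeight q m n i 0 =
        (if i = m then (q : ℂ) else 1) * (if i = n then (q : ℂ)⁻¹ else 1) := by
      intro i
      by_cases h1 : i = m
      · subst h1; simp [triangularWeight, hmn]
      · simp [triangularWeight, h1]
    simp only [Fin.zero_eta, this, Finset.prod_mul_distrib]
    simp [hq']
  · simp [triangularWeight]

theorem lift_triangularEntry_qdet (hq : q ≠ 0) {m n : Fin N} (hmn : m < n) :
    FreeAlgebra.lift ℂ (fun p : Fin N × Fin N => triangularEntry q m n p.1 p.2) (qdet q N) = 1 := by
  have hprod (σ : Equiv.Perm (Fin N)) :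
      FreeAlgebra.lift ℂ (fun p : Fin N × Fin N => triangularEntry q m n p.1 p.2)
        (List.ofFn fun i : Fin N => X i (σ i)).prod =
      (List.ofFn fun i => triangularEntry q m n i (σ i)).prod := by
    rw [map_list_prod, List.map_ofFn]
    congr 2
    ext1 i
    simp [X]
  simp only [qdet, map_sum, map_smul, hprod]
  rw [Finset.sum_eq_single 1]
  · have : (fun i => triangularEntry q m n i ((1 : Equiv.Perm (Fin N)) i)) =
        Matrix.diagonalRingHom (Fin 2) ℂ ∘ triangularWeight q m n := by
      ext1 i
      simp [triangularEntry_self]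
    rw [inversions_one, this, ← List.map_ofFn, ← map_list_prod, List.prod_ofFn,
      prod_triangularWeight q hq hmn.ne]
    simp
  · intro σ _ hσ
    obtain ⟨i, hi⟩ := exists_apply_lt_of_ne_one hσ
    rw [List.prod_eq_zero, smul_zero]
    exact (List.mem_ofFn' _ _).2 ⟨i, triangularEntry_of_lt q hmn hi⟩
  · simp

theorem triangularEntry_col (hq : q ≠ 0) {m n i k : Fin N} (hmn : m < n) (j : Fin N)
    (hik : i < k) :
    triangularEntry q m n i j * triangularEntry q m n k j =
      (q : ℂ) • (triangularEntry q m n k j * triangularEntry q m n i j) := by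
  have hq' : (q : ℂ) ≠ 0 := by exact_mod_cast hq
  rcases lt_or_ge j k with hjk | hkj
  · simp [triangularEntry_of_lt q hmn hjk]
  by_cases h1 : i = m ∧ j = n
  · obtain ⟨rfl, rfl⟩ := h1
    by_cases h2 : k = j
    · subst h2
      rw [triangularEntry_edge q hmn.ne, triangularEntry_self]
      ext s t
      fin_cases s <;> fin_cases t <;> simp [triangularWeight, hmn.ne', hq']
    · simp [triangularEntry_eq_zero q h2 (m := i) (n := j) (fun h => hik.ne' h.1)]
  · simp [triangularEntry_eq_zero q (hik.trans_le hkj).ne h1]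

theorem triangularEntry_row {m n : Fin N} (hmn : m < n) (i : Fin N) {j l : Fin N}
    (hjl : j < l) :
    triangularEntry q m n i j * triangularEntry q m n i l =
      (q : ℂ) • (triangularEntry q m n i l * triangularEntry q m n i j) := by
  rcases lt_or_ge j i with hji | hij
  · simp [triangularEntry_of_lt q hmn hji]
  by_cases h1 : i = m ∧ l = n
  · obtain ⟨rfl, rfl⟩ := h1
    by_cases h2 : i = j
    · subst h2
      rw [triangularEntry_edge q hmn.ne, triangularEntry_self]
      ext s t
      simp only [Matrix.smul_apply, Matrix.mul_diagonal, Matrix.diagonal_mul]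
      fin_cases s <;> fin_cases t <;> simp [triangularWeight]
    · simp [triangularEntry_eq_zero q h2 (m := i) (n := l) (fun h => hjl.ne h.2)]
  · simp [triangularEntry_eq_zero q (hij.trans_lt hjl).ne h1]

theorem triangularEntry_mul_eq_zero {m n i k j l : Fin N} (hmn : (m : ℕ) + 1 = n) (hik : i < k)
    (hjl : j < l) :
    triangularEntry q m n i l * triangularEntry q m n k j = 0 ∧
      triangularEntry q m n k j * triangularEntry q m n i l = 0 := by
  have hlt : m < n := by rw [Fin.lt_def]; omega
  rcases lt_or_ge j k with hjk | hkj
  · simp [triangularEntry_of_lt q hlt hjk]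
  · have h1 : i ≠ l := by omega
    have h2 : ¬ (i = m ∧ l = n) := by rintro ⟨rfl, rfl⟩; omega
    simp [triangularEntry_eq_zero q h1 h2]

theorem triangularEntry_commute {m n i k j l : Fin N} (hik : i < k) (hjl : j < l) :
    triangularEntry q m n i j * triangularEntry q m n k l =
      triangularEntry q m n k l * triangularEntry q m n i j := by
  have aux {a : Fin N} (h1 : a ≠ m) (h2 : a ≠ n) : triangularEntry q m n a a = 1 := by
    rw [triangularEntry_self, ← Matrix.diagonal_one]
    congr 1
    ext s
    fin_cases s <;> simp [triangularWeight, h1, h2]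
  by_cases h1 : i = j
  · subst h1
    by_cases h2 : k = l
    · subst h2
      simp [triangularEntry_self, mul_comm]
    by_cases h3 : k = m ∧ l = n
    · rw [aux (h3.1 ▸ hik.ne) (h3.2 ▸ hjl.ne), one_mul, mul_one]
    · simp [triangularEntry_eq_zero q h2 h3]
  by_cases h3 : i = m ∧ j = n
  · have h4 : ¬ (k = m ∧ l = n) := fun h => hik.ne (h3.1.trans h.1.symm)
    by_cases h2 : k = l
    · subst h2
      rw [aux (h3.1 ▸ hik.ne') (h3.2 ▸ hjl.ne'), one_mul, mul_one]
    · simp [triangularEntry_eq_zero q h2 h4]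
  · simp [triangularEntry_eq_zero q h1 h3]

/-- The representation of `O(SL_q(N))` on `ℂ²` determined by `triangularEntry`. -/
theorem exists_triangular_rep (hq : q ≠ 0) {m n : Fin N} (hmn : (m : ℕ) + 1 = n) :
    ∃ ρ : A q N →ₐ[ℂ] Matrix (Fin 2) (Fin 2) ℂ,
      ∀ i j, ρ (u q i j) = triangularEntry q m n i j := by
  have hlt : m < n := by rw [Fin.lt_def]; omega
  let f : F N →ₐ[ℂ] Matrix (Fin 2) (Fin 2) ℂ :=
    FreeAlgebra.lift ℂ fun p => triangularEntry q m n p.1 p.2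
  have hX (i j : Fin N) : f (X i j) = triangularEntry q m n i j := by simp [f, X]
  have hf : ∀ ⦃x y⦄, Rel q N x y → f x = f y := by
    intro x y hxy
    induction hxy with
    | col j hik => simpa only [map_mul, map_smul, hX] using triangularEntry_col q hq hlt j hik
    | row i hjl => simpa only [map_mul, map_smul, hX] using triangularEntry_row q hlt i hjl
    | comm hik hjl =>
      obtain ⟨h1, h2⟩ := triangularEntry_mul_eq_zero q hmn hik hjl
      simp only [map_mul, hX, h1, h2]
    | cross hik hjl =>
      obtain ⟨h1, -⟩ := triangularEntry_mul_eq_zero q hmn hik hjl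
      simp only [map_mul, map_sub, map_smul, hX, h1, smul_zero, sub_eq_zero]
      exact triangularEntry_commute q hik hjl
    | det => simpa using lift_triangularEntry_qdet q hq hlt
  refine ⟨RingQuot.liftAlgHom ℂ ⟨f, hf⟩, fun i j => ?_⟩
  rw [u, RingQuot.liftAlgHom_mkAlgHom_apply, hX]

theorem exists_coordinate_functional (hq : q ≠ 0) {m n : Fin N} (hmn : (m : ℕ) + 1 = n) :
    ∃ φ : A q N →ₗ[ℂ] ℂ, ∀ i j, φ (u q i j) = if i = m ∧ j = n then 1 else 0 := by
  obtain ⟨ρ, hρ⟩ := exists_triangular_rep q hq hmn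
  refine ⟨(Matrix.entryLinearMap ℂ ℂ 0 1).comp ρ.toLinearMap, fun i j => ?_⟩
  have hne : m ≠ n := by rintro rfl; omega
  simp only [LinearMap.comp_apply, AlgHom.toLinearMap_apply, hρ, Matrix.entryLinearMap_apply,
    triangularEntry]
  by_cases hij : i = j
  · subst hij
    have : ¬ (i = m ∧ i = n) := by rintro ⟨rfl, h⟩; exact hne h
    simp [this]
  · by_cases hc : i = m ∧ j = n
    · simp [if_neg hij, if_pos hc]
    · simp [if_neg hij, if_neg hc]

/-- A scalar matrix intertwining the fundamental corepresentation has constant diagonal. -/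
theorem diagonal_eq_of_intertwiner (hq : q ≠ 0) {G : Fin N → Fin N → ℂ}
    (hG : Matrix.of (u q) * (Matrix.of fun a d => algebraMap ℂ (A q N) (G a d)) =
      (Matrix.of fun a d => algebraMap ℂ (A q N) (G a d)) * Matrix.of (u q)) (i j : Fin N) :
    G i i = G j j := by
  refine eq_of_consecutive (g := fun i => G i i) (fun m n hmn => ?_) i j
  obtain ⟨φ, hφ⟩ := exists_coordinate_functional q hq hmn
  have := congrArg (fun W => φ (W m n)) hG
  simpa [Matrix.mul_apply, ← Algebra.commutes, ← Algebra.smul_def, hφ, ite_and] using this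

end Functional

/-- For all `i, j` (one-based `i+1, j+1` for zero-based `i, j : Fin N`):
`h(S(u_{ji}) u_{ij}) = q^{N+1−2i}/[N]_q` and `h(u_{ij} S(u_{ji})) = q^{2j−N−1}/[N]_q`,
where `[N]_q = q^{N−1} + q^{N−3} + ⋯ + q^{1−N}`. -/
theorem slqN_haar_norms (q : ℝ) (hq0 : 0 < q) (hq1 : q < 1)
    (N : ℕ) (hN : 2 ≤ N)
    (Δ : A q N →ₐ[ℂ] A q N ⊗[ℂ] A q N)
    (hΔ : ∀ i j : Fin N, Δ (u q i j) = ∑ k : Fin N, u q i k ⊗ₜ[ℂ] u q k j)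
    (ε : A q N →ₐ[ℂ] ℂ)
    (hε : ∀ i j : Fin N, ε (u q i j) = if i = j then 1 else 0)
    (S : A q N →ₗ[ℂ] A q N) (hS : IsAntipode Δ ε S)
    (h : A q N →ₗ[ℂ] ℂ) (hh : IsHaarState Δ h) :
    ∀ i j : Fin N,
      h (S (u q j i) * u q i j) =
        (q : ℂ) ^ ((N : ℤ) + 1 - 2 * ((i : ℤ) + 1)) /
          ∑ k : Fin N, (q : ℂ) ^ ((N : ℤ) - 1 - 2 * (k : ℤ)) ∧
      h (u q i j * S (u q j i)) =
        (q : ℂ) ^ (2 * ((j : ℤ) + 1) - (N : ℤ) - 1) /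
          ∑ k : Fin N, (q : ℂ) ^ ((N : ℤ) - 1 - 2 * (k : ℤ)) := by
  have hq : q ≠ 0 := hq0.ne'
  have hqc : (q : ℂ) ≠ 0 := by exact_mod_cast hq
  have hN0 : 0 < N := by omega
  have hVU (i j : Fin N) : ∑ k, S (u q i k) * u q k j = if i = j then 1 else 0 := by
    have := hS.1 (u q i j)
    simpa [hΔ, hε, ite_smul] using this
  have hUV (i j : Fin N) : ∑ k, u q i k * S (u q k j) = if i = j then 1 else 0 := by
    have := hS.2 (u q i j)
    simpa [hΔ, hε, ite_smul] using this
  let U : Matrix (Fin N) (Fin N) (A q N) := Matrix.of (u q)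
  let V : Matrix (Fin N) (Fin N) (A q N) := Matrix.of fun i j => S (u q i j)
  have hVU' : V * U = 1 := by
    ext i j; simpa [Matrix.mul_apply, Matrix.one_apply, U, V] using hVU i j
  have hUV' : U * V = 1 := by
    ext i j; simpa [Matrix.mul_apply, Matrix.one_apply, U, V] using hUV i j
  have hg (a b c : Fin N) : h (S (u q b a) * u q a b) = h (S (u q c a) * u q a c) :=
    diagonal_eq_of_intertwiner q hq
      (intertwiner_of_right_invariant (U := U) (V := V) hΔ hVU' hUV' hh.2.2 a) b c
  have hk (a b c : Fin N) : h (u q a b * S (u q b a)) = h (u q c b * S (u q b c)) :=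
    diagonal_eq_of_intertwiner q hq
      (intertwiner_of_left_invariant (U := U) (V := V) hΔ hVU' hUV' hh.2.1 b) a c
  have hex (i j a c : Fin N) :
      (q : ℂ) * h (S (u q i a) * u q a i) +
          ((q : ℂ) - (q : ℂ)⁻¹) * ∑ k with k < a, h (S (u q i k) * u q k i) =
        (q : ℂ) * h (u q j c * S (u q c j)) +
          ((q : ℂ) - (q : ℂ)⁻¹) * ∑ k with c < k, h (u q j k * S (u q k j)) := by
    have := congrArg h (u_inverse_exchange q hq (V := fun i j => S (u q i j)) hVU hUV a c)
    simp only [map_add, map_smul, map_sum, smul_eq_mul] at this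
    simpa only [hg _ c i, hk a _ j] using this
  intro i j
  constructor
  · have hstep (m n : Fin N) (hmn : (m : ℕ) + 1 = n) :=
      eq_inv_sq_mul_of_head_sum hqc (fun a => hex j j a j) hmn
    have hpow := eq_mul_pow_of_ratio hstep hN0
    refine (eq_div_sum_of_proportional (g := fun a => h (S (u q j a) * u q a j))
      (w := fun k => (q : ℂ) ^ ((N : ℤ) - 1 - 2 * (k : ℤ)))
      (c := h (S (u q j ⟨0, hN0⟩) * u q ⟨0, hN0⟩ j) * (q : ℂ) ^ (1 - (N : ℤ))) ?_ ?_ i).trans ?_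
    · intro a
      have e : (q : ℂ) ^ (1 - (N : ℤ)) * (q : ℂ) ^ ((N : ℤ) - 1 - 2 * (a : ℤ)) =
          (((q : ℂ) ^ 2)⁻¹) ^ (a : ℕ) := by
        rw [← zpow_add₀ hqc, inv_pow, ← pow_mul, ← zpow_natCast, ← zpow_neg]
        congr 1
        push_cast
        ring
      rw [mul_assoc, e]
      exact hpow a
    · simpa [hh.1] using congrArg h (hVU j j)
    · congr 2
      ring
  · have hstep (m n : Fin N) (hmn : (m : ℕ) + 1 = n) :=
      eq_sq_mul_of_tail_sum hqc (fun a => (hex i i i a).symm) hmn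
    have hpow := eq_mul_pow_of_ratio hstep hN0
    have hsum : ∑ k : Fin N, (q : ℂ) ^ ((N : ℤ) - 1 - 2 * (k : ℤ)) =
        ∑ k : Fin N, (q : ℂ) ^ (2 * ((k : ℤ) + 1) - (N : ℤ) - 1) := by
      rw [← Equiv.sum_comp Fin.revPerm]
      refine Finset.sum_congr rfl fun k _ => ?_
      congr 1
      rw [Fin.revPerm_apply, Fin.val_rev, Nat.cast_sub (by omega)]
      push_cast
      ring
    rw [hsum]
    refine eq_div_sum_of_proportional (g := fun a => h (u q i a * S (u q a i)))
      (w := fun k => (q : ℂ) ^ (2 * ((k : ℤ) + 1) - (N : ℤ) - 1))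
      (c := h (u q i ⟨0, hN0⟩ * S (u q ⟨0, hN0⟩ i)) * (q : ℂ) ^ ((N : ℤ) - 1)) ?_ ?_ j
    · intro a
      have e : (q : ℂ) ^ ((N : ℤ) - 1) * (q : ℂ) ^ (2 * ((a : ℤ) + 1) - (N : ℤ) - 1) =
          ((q : ℂ) ^ 2) ^ (a : ℕ) := by
        rw [← zpow_add₀ hqc, ← pow_mul, ← zpow_natCast]
        congr 1
        push_cast
        ring
      rw [mul_assoc, e]
      exact hpow a
    · simpa [hh.1] using congrArg h (hUV i i)

end SLqN
end
end
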